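/- Let α ∈ (0, 1), τ₀ > 0 and c > 0. Then the limit as t → +∞ of E_α(−((t + c)/τ₀)^α) / E_α(−(t/τ₀)^α) equals 1. Consequently, with σ_R(t) = k₀ E_α(−((t + c)/τ₀)^α) and σ_F(t) = σ₀ E_α(−(t/τ₀)^α) for k₀ > σ₀ > 0, the ratio σ_R(t)/σ_F(t) tends to k₀/σ₀ as t → +∞. -/

import Mathlib

/-- The two-parameter Mittag-Leffler function `E_{α,β}(x) = ∑ x ^ k / Γ(α k + β)`
for real `x`. The classical Mittag-Leffler function is `E_α = E_{α,1}`. -/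
noncomputable def mittagLeffler (α β : ℝ) (x : ℝ) : ℝ :=
  ∑' k : ℕ, x ^ k / Real.Gamma (α * k + β)

open MeasureTheory Set Filter Topology

/-- An exponential-times-power lower bound for the Gamma function. -/
theorem exp_neg_mul_rpow_le_Gamma {R y : ℝ} (hR : 0 < R) (hy : 1 ≤ y) :
    Real.exp (-R) * R ^ (y - 1) ≤ Real.Gamma y := by
  have hint := Real.GammaIntegral_convergent (zero_lt_one.trans_le hy)
  have hexp : IntegrableOn (fun u : ℝ => Real.exp (-u) * R ^ (y - 1)) (Ioi R) :=
    (integrableOn_exp_neg_Ioi R).mul_const _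
  rw [Real.Gamma_eq_integral (zero_lt_one.trans_le hy), ← integral_exp_neg_Ioi R,
    ← integral_mul_const]
  calc ∫ u in Ioi R, Real.exp (-u) * R ^ (y - 1)
      ≤ ∫ u in Ioi R, Real.exp (-u) * u ^ (y - 1) := by
        refine setIntegral_mono_on hexp (hint.mono_set (Ioi_subset_Ioi hR.le)) measurableSet_Ioi ?_
        intro u hu
        have : R ^ (y - 1) ≤ u ^ (y - 1) :=
          Real.rpow_le_rpow hR.le (le_of_lt hu) (by linarith)
        gcongr
    _ ≤ ∫ u in Ioi (0 : ℝ), Real.exp (-u) * u ^ (y - 1) := by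
        refine setIntegral_mono_set hint ?_ (Ioi_subset_Ioi hR.le).eventuallyLE
        filter_upwards [ae_restrict_mem measurableSet_Ioi] with u hu
        have : (0 : ℝ) < u := hu
        simp only [Pi.zero_apply]
        positivity

theorem summable_pow_div_Gamma {α β : ℝ} (hα : 0 < α) (hβ : 1 ≤ β) (x : ℝ) :
    Summable fun k : ℕ => x ^ k / Real.Gamma (α * k + β) := by
  set R : ℝ := (2 * |x| + 1) ^ α⁻¹ with hR
  have hx : 0 < 2 * |x| + 1 := by positivity
  have hRpos : 0 < R := by positivity
  have hRα : R ^ α = 2 * |x| + 1 := by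
    rw [hR, ← Real.rpow_mul hx.le, inv_mul_cancel₀ hα.ne', Real.rpow_one]
  have hgeo : Summable fun k : ℕ =>
      (Real.exp R * R ^ (1 - β)) * (|x| / (2 * |x| + 1)) ^ k := by
    refine (summable_geometric_of_lt_one (by positivity) ?_).mul_left _
    rw [div_lt_one hx]
    linarith [abs_nonneg x]
  refine Summable.of_norm_bounded hgeo fun k => ?_
  have hy : 1 ≤ α * k + β := by
    have : 0 ≤ α * k := by positivity
    linarith
  have hG := exp_neg_mul_rpow_le_Gamma hRpos hy
  have hlow : Real.exp (-R) * R ^ (α * k + β - 1)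
      = (2 * |x| + 1) ^ k / (Real.exp R * R ^ (1 - β)) := by
    rw [show α * (k : ℝ) + β - 1 = α * k - (1 - β) by ring, Real.rpow_sub hRpos,
      Real.rpow_mul hRpos.le, hRα, Real.rpow_natCast, Real.exp_neg]
    field_simp
  rw [hlow] at hG
  rw [Real.norm_eq_abs, abs_div, abs_pow, abs_of_pos (Real.Gamma_pos_of_pos (by linarith)), div_pow]
  calc |x| ^ k / Real.Gamma (α * k + β)
      ≤ |x| ^ k / ((2 * |x| + 1) ^ k / (Real.exp R * R ^ (1 - β))) := by gcongr
    _ = _ := by field_simp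

theorem hasSum_mittagLeffler {α β : ℝ} (hα : 0 < α) (hβ : 1 ≤ β) (x : ℝ) :
    HasSum (fun k : ℕ => x ^ k / Real.Gamma (α * k + β)) (mittagLeffler α β x) :=
  (summable_pow_div_Gamma hα hβ x).hasSum

theorem continuous_mittagLeffler {α β : ℝ} (hα : 0 < α) (hβ : 1 ≤ β) :
    Continuous (mittagLeffler α β) := by
  rw [continuous_iff_continuousAt]
  intro x
  have hs : Metric.closedBall (0 : ℝ) (|x| + 1) ∈ 𝓝 x :=
    Metric.closedBall_mem_nhds_of_mem (by simp)
  refine ContinuousOn.continuousAt ?_ hs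
  refine continuousOn_tsum (fun k => by fun_prop) (summable_pow_div_Gamma hα hβ (|x| + 1)) ?_
  intro k y hy
  have hy' : |y| ≤ |x| + 1 := by simpa using hy
  have hG : 0 < Real.Gamma (α * k + β) := Real.Gamma_pos_of_pos (by positivity)
  rw [Real.norm_eq_abs, abs_div, abs_pow, abs_of_pos hG]
  gcongr

/-- The Euler beta integral on `[0, t]`. -/
theorem integral_rpow_mul_sub_rpow {p q t : ℝ} (hp : 0 < p) (hq : 0 < q) (ht : 0 < t) :
    IntervalIntegrable (fun s : ℝ => s ^ (p - 1) * (t - s) ^ (q - 1)) volume 0 t ∧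
    ∫ s in (0 : ℝ)..t, s ^ (p - 1) * (t - s) ^ (q - 1) =
      t ^ (p + q - 1) * (Real.Gamma p * Real.Gamma q / Real.Gamma (p + q)) := by
  have hval : ∫ s in (0 : ℝ)..t, s ^ (p - 1) * (t - s) ^ (q - 1) =
      t ^ (p + q - 1) * (Real.Gamma p * Real.Gamma q / Real.Gamma (p + q)) := by
    have h := Complex.betaIntegral_scaled p q ht
    rw [Complex.betaIntegral_eq_Gamma_mul_div _ _ (by simpa) (by simpa)] at h
    have hcongr : ∫ s in (0 : ℝ)..t, (s : ℂ) ^ ((p : ℂ) - 1) * ((t : ℂ) - s) ^ ((q : ℂ) - 1)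
        = ((∫ s in (0 : ℝ)..t, s ^ (p - 1) * (t - s) ^ (q - 1) : ℝ) : ℂ) := by
      rw [← intervalIntegral.integral_ofReal]
      refine intervalIntegral.integral_congr fun s hs => ?_
      rw [uIcc_of_le ht.le] at hs
      push_cast [Complex.ofReal_cpow hs.1, Complex.ofReal_cpow (sub_nonneg.2 hs.2)]
      rfl
    rw [hcongr, ← Complex.ofReal_add, Complex.Gamma_ofReal, Complex.Gamma_ofReal,
      Complex.Gamma_ofReal, ← Complex.ofReal_one, ← Complex.ofReal_sub,
      ← Complex.ofReal_cpow ht.le] at h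
    exact_mod_cast h
  refine ⟨?_, hval⟩
  by_contra hni
  rw [intervalIntegral.integral_undef hni] at hval
  have h1 := Real.Gamma_pos_of_pos hp
  have h2 := Real.Gamma_pos_of_pos hq
  have h3 := Real.Gamma_pos_of_pos (add_pos hp hq)
  have : 0 < t ^ (p + q - 1) * (Real.Gamma p * Real.Gamma q / Real.Gamma (p + q)) := by positivity
  exact this.ne hval

theorem hasSum_of_forall_eq {f g : ℕ → ℝ} {a : ℝ} (hf : HasSum f a) (h : ∀ k, g k = f k) :
    HasSum g a := by
  rwa [funext h]

/-- Termwise integration of a series with nonnegative integrable profiles. -/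
theorem intervalIntegrable_and_hasSum_integral {t : ℝ} (ht : 0 ≤ t) {c I : ℕ → ℝ}
    {φ : ℕ → ℝ → ℝ} {G : ℝ → ℝ} (hφ : ∀ k, IntervalIntegrable (φ k) volume 0 t)
    (hnn : ∀ k, ∀ s ∈ Ioc 0 t, 0 ≤ φ k s) (hI : ∀ k, ∫ s in (0 : ℝ)..t, φ k s = I k)
    (hsum : Summable fun k => |c k| * I k)
    (hG : ∀ s ∈ Ioc 0 t, HasSum (fun k => c k * φ k s) (G s)) :
    IntervalIntegrable G volume 0 t ∧
      HasSum (fun k => c k * I k) (∫ s in (0 : ℝ)..t, G s) := by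
  set μ := volume.restrict (Ioc 0 t)
  have hint : ∀ k, Integrable (fun s => c k * φ k s) μ := fun k => by
    have := (hφ k).const_mul (c k)
    rwa [intervalIntegrable_iff_integrableOn_Ioc_of_le ht] at this
  have hnorm : ∀ k, ∫ s, ‖c k * φ k s‖ ∂μ = |c k| * I k := fun k => by
    rw [← hI k, intervalIntegral.integral_of_le ht, ← integral_const_mul]
    refine setIntegral_congr_fun measurableSet_Ioc fun s hs => ?_
    simp only [norm_mul, Real.norm_eq_abs, abs_of_nonneg (hnn k s hs)]
  have hsum' : Summable fun k => ∫ s, ‖c k * φ k s‖ ∂μ := by simpa only [hnorm] using hsum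
  have hae : ∀ᵐ s ∂μ, HasSum (fun k => c k * φ k s) (G s) := by
    filter_upwards [ae_restrict_mem measurableSet_Ioc] with s hs using hG s hs
  have hHS := hasSum_integral_of_summable_integral_norm hint hsum'
  have hGe : ∫ s, ∑' k, c k * φ k s ∂μ = ∫ s in (0 : ℝ)..t, G s := by
    rw [intervalIntegral.integral_of_le ht]
    exact integral_congr_ae (by filter_upwards [hae] with s hs using hs.tsum_eq)
  constructor
  · rw [intervalIntegrable_iff_integrableOn_Ioc_of_le ht]
    refine ⟨aestronglyMeasurable_of_tendsto_ae atTop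
      (f := fun n s => ∑ k ∈ Finset.range n, c k * φ k s) (fun n => ?_) ?_, ?_⟩
    · exact (integrable_finsetSum _ fun k _ => hint k).aestronglyMeasurable
    · filter_upwards [hae] with s hs using hs.tendsto_sum_nat
    · have hle : ∫⁻ s, ‖G s‖ₑ ∂μ ≤ ∑' k, ∫⁻ s, ‖c k * φ k s‖ₑ ∂μ := by
        rw [← lintegral_tsum fun k => (hint k).aestronglyMeasurable.enorm]
        refine lintegral_mono_ae ?_
        filter_upwards [hae] with s hs
        rw [← hs.tsum_eq]
        exact enorm_tsum_le_tsum_enorm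
      refine lt_of_le_of_lt hle ?_
      have heq : ∀ k, ∫⁻ s, ‖c k * φ k s‖ₑ ∂μ = ENNReal.ofReal (∫ s, ‖c k * φ k s‖ ∂μ) :=
        fun k => (ofReal_integral_norm_eq_lintegral_enorm (hint k)).symm
      simp_rw [heq]
      exact hsum'.tsum_ofReal_lt_top
  · rw [hGe] at hHS
    refine hasSum_of_forall_eq hHS fun k => ?_
    rw [← hI k, intervalIntegral.integral_of_le ht, ← integral_const_mul]

theorem rpow_sub_rpow_le {a s t : ℝ} (ha : 0 < a) (hs : 0 ≤ s) (ht : 0 < t) (hst : s ≤ t) :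
    t ^ a - s ^ a ≤ (a + 1) * t ^ (a - 1) * (t - s) := by
  have hu0 : 0 ≤ s / t := by positivity
  have hu1 : s / t ≤ 1 := (div_le_one ht).2 hst
  have h1 : 1 + (a + 1) * (s / t - 1) ≤ (s / t) ^ a := by
    have h := one_add_mul_self_le_rpow_one_add (s := s / t - 1) (by linarith)
      (p := a + 1) (by linarith)
    rw [show 1 + (s / t - 1) = s / t by ring] at h
    exact h.trans (Real.rpow_le_rpow_of_exponent_ge_of_imp hu0 hu1 (by linarith)
      (fun _ h => absurd h (by positivity)))
  rw [Real.div_rpow hs ht.le] at h1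
  have hta : 0 < t ^ a := by positivity
  rw [le_div_iff₀ hta] at h1
  rw [Real.rpow_sub_one ht.ne']
  have : (1 + (a + 1) * (s / t - 1)) * t ^ a = t ^ a - (a + 1) * (t ^ a / t) * (t - s) := by
    field_simp
    ring
  linarith

/-- The Marchaud integral of a power function. -/
theorem integral_rpow_sub_rpow_mul {α a t : ℝ} (hα1 : α < 1) (ha : 0 < a)
    (ht : 0 < t) :
    IntervalIntegrable (fun s : ℝ => (t ^ a - s ^ a) * (t - s) ^ (-α - 1)) volume 0 t ∧
    α * ∫ s in (0 : ℝ)..t, (t ^ a - s ^ a) * (t - s) ^ (-α - 1) =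
      Real.Gamma (1 - α) * (Real.Gamma (a + 1) / Real.Gamma (a + 1 - α)) * t ^ (a - α)
        - t ^ (a - α) := by
  have hq : 0 < 1 - α := by linarith
  obtain ⟨hBint, hB⟩ := integral_rpow_mul_sub_rpow ha hq ht
  rw [show (1 : ℝ) - α - 1 = -α by ring] at hBint hB
  have h1int : IntervalIntegrable (fun s : ℝ => (t - s) ^ (-α)) volume 0 t := by
    have h := (integral_rpow_mul_sub_rpow one_pos hq ht).1
    simpa [show (1 : ℝ) - α - 1 = -α by ring] using h
  have hpow : ∀ s, s < t → (t - s) * (t - s) ^ (-α - 1) = (t - s) ^ (-α) := fun s hs => by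
    have : 0 < t - s := sub_pos.2 hs
    rw [Real.rpow_sub_one this.ne']
    field_simp
  have hint : IntervalIntegrable (fun s : ℝ => (t ^ a - s ^ a) * (t - s) ^ (-α - 1))
      volume 0 t := by
    refine (h1int.const_mul ((a + 1) * t ^ (a - 1))).mono_fun' ?_ ?_
    · exact Measurable.aestronglyMeasurable (by fun_prop)
    · rw [uIoc_of_le ht.le]
      filter_upwards [ae_restrict_mem measurableSet_Ioc] with s hs
      have hmono : s ^ a ≤ t ^ a := Real.rpow_le_rpow hs.1.le hs.2 ha.le
      have hnn : 0 ≤ (t - s) ^ (-α - 1) := Real.rpow_nonneg (sub_nonneg.2 hs.2) _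
      rw [Real.norm_of_nonneg (mul_nonneg (sub_nonneg.2 hmono) hnn)]
      rcases hs.2.eq_or_lt with h | h
      · subst h
        simp only [sub_self, zero_mul]
        positivity
      · rw [← hpow s h, ← mul_assoc]
        exact mul_le_mul_of_nonneg_right (rpow_sub_rpow_le ha hs.1.le ht hs.2) hnn
  refine ⟨hint, ?_⟩
  have hcont : ContinuousOn (fun s : ℝ => (t ^ a - s ^ a) * (t - s) ^ (-α)) (Icc 0 t) := by
    intro s hs
    rcases hs.2.eq_or_lt with h | h
    · subst h
      have hlim : Tendsto (fun u : ℝ => (a + 1) * s ^ (a - 1) * (s - u) ^ (1 - α))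
          (𝓝[Icc 0 s] s) (𝓝 0) := by
        have hc : Continuous fun u : ℝ => (a + 1) * s ^ (a - 1) * (s - u) ^ (1 - α) :=
          continuous_const.mul ((continuous_const.sub continuous_id).rpow_const
            fun _ => Or.inr hq.le)
        have := (hc.tendsto s).mono_left (nhdsWithin_le_nhds (s := Icc 0 s))
        simpa [Real.zero_rpow hq.ne'] using this
      have : Tendsto (fun u : ℝ => (s ^ a - u ^ a) * (s - u) ^ (-α)) (𝓝[Icc 0 s] s) (𝓝 0) := by
        refine tendsto_of_tendsto_of_tendsto_of_le_of_le' tendsto_const_nhds hlim ?_ ?_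
        · filter_upwards [self_mem_nhdsWithin] with u hu
          exact mul_nonneg (sub_nonneg.2 (Real.rpow_le_rpow hu.1 hu.2 ha.le))
            (Real.rpow_nonneg (sub_nonneg.2 hu.2) _)
        · filter_upwards [self_mem_nhdsWithin] with u hu
          rcases hu.2.eq_or_lt with h | h
          · subst h
            simp [Real.zero_rpow hq.ne']
          · have hsu : 0 < s - u := sub_pos.2 h
            rw [show 1 - α = -α + 1 by ring, Real.rpow_add_one hsu.ne']
            have := mul_le_mul_of_nonneg_right (rpow_sub_rpow_le ha hu.1 ht hu.2)
              (Real.rpow_nonneg hsu.le (-α))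
            linarith
      simpa [ContinuousWithinAt] using this
    · refine ContinuousAt.continuousWithinAt (ContinuousAt.mul ?_ ?_)
      · exact continuousAt_const.sub (Real.continuousAt_rpow_const _ _ (Or.inr ha.le))
      · exact (continuousAt_const.sub continuousAt_id).rpow_const
          (Or.inl (sub_pos.2 h).ne')
  have hderiv : ∀ s ∈ Ioo 0 t, HasDerivAt (fun s : ℝ => (t ^ a - s ^ a) * (t - s) ^ (-α))
      (α * ((t ^ a - s ^ a) * (t - s) ^ (-α - 1)) - a * (s ^ (a - 1) * (t - s) ^ (-α))) s := by
    intro s hs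
    have h1 : HasDerivAt (fun s : ℝ => t ^ a - s ^ a) (-(a * s ^ (a - 1))) s :=
      (Real.hasDerivAt_rpow_const (Or.inl hs.1.ne')).const_sub _
    have h2 : HasDerivAt (fun s : ℝ => (t - s) ^ (-α)) (-1 * -α * (t - s) ^ (-α - 1)) s :=
      ((hasDerivAt_id s).const_sub t).rpow_const (Or.inl (sub_pos.2 hs.2).ne')
    refine (h1.mul h2).congr_deriv ?_
    ring
  have hFTC := intervalIntegral.integral_eq_sub_of_hasDerivAt_of_le ht.le hcont hderiv
    ((hint.const_mul α).sub (hBint.const_mul a))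
  rw [intervalIntegral.integral_sub (hint.const_mul α) (hBint.const_mul a),
    intervalIntegral.integral_const_mul, intervalIntegral.integral_const_mul, hB] at hFTC
  simp only [sub_self, zero_mul, sub_zero, Real.zero_rpow ha.ne'] at hFTC
  rw [show a + (1 - α) = a + 1 - α by ring, show a + 1 - α - 1 = a - α by ring] at hFTC
  have hpa : t ^ a * t ^ (-α) = t ^ (a - α) := by rw [← Real.rpow_add ht, ← sub_eq_add_neg]
  rw [Real.Gamma_add_one ha.ne']
  linear_combination hFTC - hpa

/-- The fractional relaxation function `t ↦ E_α(-t ^ α)`. -/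
noncomputable def fractionalRelaxation (α t : ℝ) : ℝ := mittagLeffler α 1 (-(t ^ α))

theorem continuous_fractionalRelaxation {α : ℝ} (hα : 0 < α) :
    Continuous (fractionalRelaxation α) :=
  (continuous_mittagLeffler hα le_rfl).comp (Real.continuous_rpow_const hα.le).neg

theorem hasSum_neg_rpow {α β t : ℝ} (hα : 0 < α) (hβ : 1 ≤ β) (ht : 0 ≤ t) :
    HasSum (fun k : ℕ => (-1) ^ k / Real.Gamma (α * k + β) * t ^ (α * k))
      (mittagLeffler α β (-(t ^ α))) := by
  convert hasSum_mittagLeffler hα hβ (-(t ^ α)) using 1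
  funext k
  rw [Real.rpow_mul_natCast ht, neg_pow]
  ring

theorem summable_rpow_div_Gamma {α β t : ℝ} (hα : 0 < α) (hβ : 1 ≤ β) (ht : 0 ≤ t) :
    Summable (fun k : ℕ => t ^ (α * k) / Real.Gamma (α * k + β)) := by
  convert summable_pow_div_Gamma hα hβ (t ^ α) using 3 with k
  rw [Real.rpow_mul_natCast ht]

theorem fractionalRelaxation_zero {α : ℝ} (hα : 0 < α) : fractionalRelaxation α 0 = 1 := by
  have h := hasSum_mittagLeffler hα le_rfl 0
  rw [fractionalRelaxation, Real.zero_rpow hα.ne', neg_zero, ← h.tsum_eq, tsum_eq_single 0]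
  · simp
  · intro k hk
    simp [hk]

/-- The fractional relaxation equation, in Marchaud form. -/
theorem fractionalRelaxation_marchaud {α t : ℝ} (hα0 : 0 < α) (hα1 : α < 1) (ht : 0 < t) :
    IntervalIntegrable (fun s => (fractionalRelaxation α t - fractionalRelaxation α s) *
      (t - s) ^ (-α - 1)) volume 0 t ∧
    (fractionalRelaxation α t - 1) * t ^ (-α) + α * (∫ s in (0 : ℝ)..t,
      (fractionalRelaxation α t - fractionalRelaxation α s) * (t - s) ^ (-α - 1)) =
      -(Real.Gamma (1 - α) * fractionalRelaxation α t) := by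
  have ha : ∀ k : ℕ, 0 < α * ((k + 1 : ℕ) : ℝ) := fun k => by positivity
  have hterm := fun k : ℕ => integral_rpow_sub_rpow_mul hα1 (ha k) ht
  have hshift : ∀ s, 0 ≤ s → HasSum (fun k : ℕ => (-1) ^ (k + 1) /
      Real.Gamma (α * ((k + 1 : ℕ) : ℝ) + 1) * s ^ (α * ((k + 1 : ℕ) : ℝ)))
      (fractionalRelaxation α s - 1) := fun s hs => by
    have h := (hasSum_nat_add_iff' 1).2 (hasSum_neg_rpow hα0 le_rfl hs)
    simpa [fractionalRelaxation] using h
  have hI : ∀ k : ℕ, ∫ s in (0 : ℝ)..t, (t ^ (α * ((k + 1 : ℕ) : ℝ)) - s ^ (α * ((k + 1 : ℕ) : ℝ)))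
        * (t - s) ^ (-α - 1) =
      (Real.Gamma (1 - α) * (Real.Gamma (α * ((k + 1 : ℕ) : ℝ) + 1) /
        Real.Gamma (α * k + 1)) * t ^ (α * (k : ℝ)) - t ^ (-α) * t ^ (α * ((k + 1 : ℕ) : ℝ))) / α :=
    fun k => by
      have h := (hterm k).2
      rw [show α * ((k + 1 : ℕ) : ℝ) + 1 - α = α * k + 1 by push_cast; ring,
        show α * ((k + 1 : ℕ) : ℝ) - α = α * k by push_cast; ring] at h
      rw [eq_div_iff hα0.ne', mul_comm, h, ← Real.rpow_add ht,
        show -α + α * ((k + 1 : ℕ) : ℝ) = α * k by push_cast; ring]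
  have hGpos : ∀ k : ℕ, 0 < Real.Gamma (α * k + 1) := fun k =>
    Real.Gamma_pos_of_pos (by positivity)
  have hsummable : Summable fun k : ℕ => |(-1) ^ (k + 1) /
      Real.Gamma (α * ((k + 1 : ℕ) : ℝ) + 1)| * ((Real.Gamma (1 - α) *
        (Real.Gamma (α * ((k + 1 : ℕ) : ℝ) + 1) /
        Real.Gamma (α * k + 1)) * t ^ (α * (k : ℝ)) -
          t ^ (-α) * t ^ (α * ((k + 1 : ℕ) : ℝ))) / α) := by
    have h0 := summable_rpow_div_Gamma hα0 le_rfl ht.le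
    have h1 := (summable_nat_add_iff 1).2 h0
    refine (((h0.mul_left (Real.Gamma (1 - α))).sub (h1.mul_left (t ^ (-α)))).div_const α).congr ?_
    intro k
    have hk := hGpos k
    have hk1 := hGpos (k + 1)
    rw [abs_div, abs_pow, abs_neg, abs_one, one_pow, abs_of_pos hk1]
    field_simp
  obtain ⟨hint, hsum⟩ := intervalIntegrable_and_hasSum_integral ht.le
    (c := fun k : ℕ => (-1) ^ (k + 1) / Real.Gamma (α * ((k + 1 : ℕ) : ℝ) + 1))
    (G := fun s => (fractionalRelaxation α t - fractionalRelaxation α s) * (t - s) ^ (-α - 1))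
    (fun k => (hterm k).1)
    (fun k s hs => mul_nonneg
      (sub_nonneg.2 (Real.rpow_le_rpow hs.1.le hs.2 (ha k).le))
      (Real.rpow_nonneg (sub_nonneg.2 hs.2) _)) hI hsummable
    (fun s hs => by
      have h := ((hshift t ht.le).sub (hshift s hs.1.le)).mul_right ((t - s) ^ (-α - 1))
      rw [sub_sub_sub_cancel_right] at h
      exact hasSum_of_forall_eq h fun k => by ring)
  refine ⟨hint, ?_⟩
  have h2 : HasSum (fun k : ℕ => (-Real.Gamma (1 - α) * ((-1) ^ k / Real.Gamma (α * k + 1)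
      * t ^ (α * (k : ℝ))) - t ^ (-α) * ((-1) ^ (k + 1) /
      Real.Gamma (α * ((k + 1 : ℕ) : ℝ) + 1) * t ^ (α * ((k + 1 : ℕ) : ℝ)))) / α)
      ((-Real.Gamma (1 - α) * fractionalRelaxation α t -
        t ^ (-α) * (fractionalRelaxation α t - 1)) / α) :=
    (((hasSum_neg_rpow hα0 le_rfl ht.le).mul_left _).sub ((hshift t ht.le).mul_left _)).div_const _
  have heq := hsum.unique (hasSum_of_forall_eq h2 fun k => ?_)
  · rw [heq]
    field_simp
    ring
  · have hk := hGpos k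
    have hk1 := hGpos (k + 1)
    field_simp
    ring

theorem antitoneOn_fractionalRelaxation {α : ℝ} (hα0 : 0 < α) (hα1 : α < 1) :
    AntitoneOn (fractionalRelaxation α) (Ici 0) := by
  intro t₁ ht₁ t₂ _ h12
  by_contra! hlt
  set f := fractionalRelaxation α with hf
  have hcont : Continuous f := continuous_fractionalRelaxation hα0
  have hf0 : f 0 = 1 := fractionalRelaxation_zero hα0
  have ht₁' : 0 ≤ t₁ := ht₁
  obtain ⟨a, ha, hamin⟩ := (isCompact_Icc (a := (0 : ℝ)) (b := t₂)).exists_isMinOn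
    ⟨t₁, ht₁', h12⟩ hcont.continuousOn
  have hmin : ∀ s ∈ Icc 0 t₂, f a ≤ f s := fun s hs => hamin hs
  obtain ⟨m, hm, hmmax⟩ := (isCompact_Icc (a := a) (b := t₂)).exists_isMaxOn
    ⟨a, le_rfl, ha.2⟩ hcont.continuousOn
  have hmax : ∀ s ∈ Icc a t₂, f s ≤ f m := fun s hs => hmmax hs
  have ham_lt : f a < f m :=
    (hmin t₁ ⟨ht₁', h12⟩).trans_lt (hlt.trans_le (hmax t₂ ⟨ha.2, le_rfl⟩))
  have ham : a < m := lt_of_le_of_ne hm.1 fun h => ham_lt.ne (by rw [h])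
  have hmpos : 0 < m := ha.1.trans_lt ham
  have hG : 0 < Real.Gamma (1 - α) := Real.Gamma_pos_of_pos (by linarith)
  obtain ⟨hmint, hmeq⟩ := fractionalRelaxation_marchaud hα0 hα1 hmpos
  rw [← hf] at hmint hmeq
  have hint1 : IntervalIntegrable (fun s => (f m - f s) * (m - s) ^ (-α - 1)) volume 0 a :=
    hmint.mono_set (uIcc_subset_uIcc_left (by rw [uIcc_of_le hmpos.le]; exact ⟨ha.1, hm.1⟩))
  have hint2 : IntervalIntegrable (fun s => (f m - f s) * (m - s) ^ (-α - 1)) volume a m :=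
    hmint.mono_set (uIcc_subset_uIcc_right (by rw [uIcc_of_le hmpos.le]; exact ⟨ha.1, hm.1⟩))
  have hsplit := intervalIntegral.integral_add_adjacent_intervals hint1 hint2
  have hlast : 0 ≤ ∫ s in a..m, (f m - f s) * (m - s) ^ (-α - 1) :=
    intervalIntegral.integral_nonneg ham.le fun s hs => mul_nonneg
      (sub_nonneg.2 (hmax s ⟨hs.1, hs.2.trans hm.2⟩)) (Real.rpow_nonneg (sub_nonneg.2 hs.2) _)
  rcases ha.1.eq_or_lt with h0 | hapos
  · subst h0
    rw [intervalIntegral.integral_same, zero_add] at hsplit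
    rw [← hsplit] at hmeq
    rw [hf0] at ham_lt
    have h1 : 0 ≤ (f m - 1) * m ^ (-α) := mul_nonneg (by linarith) (by positivity)
    have h2 := mul_nonneg hα0.le hlast
    have h3 : 0 < Real.Gamma (1 - α) * f m := mul_pos hG (by linarith)
    linarith
  · obtain ⟨haint, haeq⟩ := fractionalRelaxation_marchaud hα0 hα1 hapos
    rw [← hf] at haint haeq
    have hfirst : ∫ s in (0 : ℝ)..a, (f a - f s) * (a - s) ^ (-α - 1) ≤
        ∫ s in (0 : ℝ)..a, (f m - f s) * (m - s) ^ (-α - 1) := by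
      refine intervalIntegral.integral_mono_on_of_le_Ioo hapos.le haint hint1 fun s hs => ?_
      have hpos : 0 < a - s := sub_pos.2 hs.2
      have hk : (m - s) ^ (-α - 1) ≤ (a - s) ^ (-α - 1) :=
        Real.rpow_le_rpow_of_nonpos hpos (by linarith) (by linarith)
      have hk0 : 0 ≤ (m - s) ^ (-α - 1) := Real.rpow_nonneg (by linarith) _
      have hfs := hmin s ⟨hs.1.le, hs.2.le.trans ha.2⟩
      calc (f a - f s) * (a - s) ^ (-α - 1) ≤ (f a - f s) * (m - s) ^ (-α - 1) :=
            mul_le_mul_of_nonpos_left hk (by linarith)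
        _ ≤ (f m - f s) * (m - s) ^ (-α - 1) := by gcongr
    have hfa1 : f a ≤ 1 := hf0 ▸ hmin 0 ⟨le_rfl, ha.1.trans ha.2⟩
    have hbdry : (f a - 1) * a ^ (-α) ≤ (f m - 1) * m ^ (-α) := by
      have hk : m ^ (-α) ≤ a ^ (-α) :=
        Real.rpow_le_rpow_of_nonpos hapos ham.le (by linarith)
      have hk0 : 0 ≤ m ^ (-α) := by positivity
      calc (f a - 1) * a ^ (-α) ≤ (f a - 1) * m ^ (-α) :=
            mul_le_mul_of_nonpos_left hk (by linarith)
        _ ≤ (f m - 1) * m ^ (-α) := by gcongr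
    rw [← hsplit, mul_add] at hmeq
    have h1 := mul_le_mul_of_nonneg_left hfirst hα0.le
    have h2 := mul_nonneg hα0.le hlast
    have h3 := mul_lt_mul_of_pos_left ham_lt hG
    linarith

theorem fractionalRelaxation_nonneg {α t : ℝ} (hα0 : 0 < α) (hα1 : α < 1) (ht : 0 ≤ t) :
    0 ≤ fractionalRelaxation α t := by
  have hanti := antitoneOn_fractionalRelaxation hα0 hα1
  rcases ht.eq_or_lt with rfl | htpos
  · rw [fractionalRelaxation_zero hα0]
    exact zero_le_one
  have heq := (fractionalRelaxation_marchaud hα0 hα1 htpos).2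
  have hle1 : fractionalRelaxation α t ≤ 1 :=
    fractionalRelaxation_zero hα0 ▸ hanti self_mem_Ici ht ht
  have h1 : (fractionalRelaxation α t - 1) * t ^ (-α) ≤ 0 :=
    mul_nonpos_of_nonpos_of_nonneg (by linarith) (by positivity)
  have h2 : ∫ s in (0 : ℝ)..t, (fractionalRelaxation α t - fractionalRelaxation α s) *
      (t - s) ^ (-α - 1) ≤ 0 := by
    rw [← neg_nonneg, ← intervalIntegral.integral_neg]
    refine intervalIntegral.integral_nonneg ht fun s hs => neg_nonneg.2 ?_
    exact mul_nonpos_of_nonpos_of_nonneg (sub_nonpos.2 (hanti hs.1 ht hs.2))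
      (Real.rpow_nonneg (sub_nonneg.2 hs.2) _)
  have h3 := mul_nonpos_of_nonneg_of_nonpos hα0.le h2
  have hG : 0 < Real.Gamma (1 - α) := Real.Gamma_pos_of_pos (by linarith)
  exact nonneg_of_mul_nonneg_right (by linarith) hG

/-- The fractional relaxation equation, in integrated form. -/
theorem fractionalRelaxation_integral_eq {α t : ℝ} (hα0 : 0 < α) (hα1 : α < 1) (ht : 0 < t) :
    IntervalIntegrable (fun s => fractionalRelaxation α s * (t - s) ^ (-α)) volume 0 t ∧
    (∫ s in (0 : ℝ)..t, fractionalRelaxation α s * (t - s) ^ (-α)) +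
      Real.Gamma (1 - α) * (∫ s in (0 : ℝ)..t, fractionalRelaxation α s) =
      t ^ (1 - α) / (1 - α) := by
  have hq : 0 < 1 - α := by linarith
  have hp : ∀ k : ℕ, 0 < α * k + 1 := fun k => by positivity
  have hG := fun k => Real.Gamma_pos_of_pos (hp k)
  have hG2 : ∀ k : ℕ, 0 < Real.Gamma (α * k + (2 - α)) := fun k =>
    Real.Gamma_pos_of_pos (by linarith [hp k])
  have hser := fun s hs => hasSum_neg_rpow (t := s) hα0 le_rfl hs
  have habs : ∀ k : ℕ, |(-1) ^ k / Real.Gamma (α * k + 1)| = 1 / Real.Gamma (α * k + 1) :=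
    fun k => by rw [abs_div, abs_pow, abs_neg, abs_one, one_pow, abs_of_pos (hG k)]
  have hbeta : ∀ k : ℕ,
      IntervalIntegrable (fun s : ℝ => s ^ (α * k) * (t - s) ^ (-α)) volume 0 t ∧
      ∫ s in (0 : ℝ)..t, s ^ (α * k) * (t - s) ^ (-α) =
      t ^ (1 - α) * t ^ (α * k) * (Real.Gamma (α * k + 1) * Real.Gamma (1 - α) /
        Real.Gamma (α * k + (2 - α))) := fun k => by
    have h := integral_rpow_mul_sub_rpow (hp k) hq ht
    rw [show (1 : ℝ) - α - 1 = -α by ring, show α * (k : ℝ) + 1 - 1 = α * k by ring,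
      show α * (k : ℝ) + 1 + (1 - α) - 1 = (1 - α) + α * k by ring, Real.rpow_add ht,
      show α * (k : ℝ) + 1 + (1 - α) = α * k + (2 - α) by ring] at h
    exact h
  obtain ⟨hint, hconv⟩ := intervalIntegrable_and_hasSum_integral ht.le
    (c := fun k : ℕ => (-1) ^ k / Real.Gamma (α * k + 1))
    (G := fun s => fractionalRelaxation α s * (t - s) ^ (-α))
    (fun k => (hbeta k).1)
    (fun k s hs => mul_nonneg (Real.rpow_nonneg hs.1.le _)
      (Real.rpow_nonneg (sub_nonneg.2 hs.2) _)) (fun k => (hbeta k).2)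
    (by
      refine ((summable_rpow_div_Gamma hα0 (β := 2 - α) (by linarith) ht.le).mul_left
        (Real.Gamma (1 - α) * t ^ (1 - α))).congr fun k => ?_
      have := hG k
      have := hG2 k
      rw [habs]
      field_simp)
    (fun s hs => hasSum_of_forall_eq ((hser s hs.1.le).mul_right _) fun k => by ring)
  have hpowint : ∀ k : ℕ, ∫ s in (0 : ℝ)..t, s ^ (α * k) = t * t ^ (α * k) / (α * k + 1) :=
    fun k => by
      have h0 : 0 ≤ α * k := by positivity
      rw [integral_rpow (Or.inl (by linarith)), Real.zero_rpow (hp k).ne', sub_zero,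
        Real.rpow_add_one ht.ne', mul_comm]
  have hGadd : ∀ k : ℕ, Real.Gamma (α * k + 2) = (α * k + 1) * Real.Gamma (α * k + 1) :=
    fun k => by rw [← Real.Gamma_add_one (hp k).ne']; ring_nf
  obtain ⟨-, hF⟩ := intervalIntegrable_and_hasSum_integral ht.le
    (c := fun k : ℕ => (-1) ^ k / Real.Gamma (α * k + 1)) (G := fractionalRelaxation α)
    (φ := fun k s => s ^ (α * k))
    (fun k => (Real.continuous_rpow_const (by positivity)).intervalIntegrable _ _)
    (fun k s hs => Real.rpow_nonneg hs.1.le _) hpowint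
    (by
      refine ((summable_rpow_div_Gamma hα0 (β := 2) (by norm_num) ht.le).mul_left t).congr
        fun k => ?_
      have := hG k
      have := hp k
      rw [habs, hGadd]
      field_simp)
    (fun s hs => hser s hs.1.le)
  have hshift := (hasSum_nat_add_iff' 1).2 hconv
  have hval := hshift.unique
    (hasSum_of_forall_eq (hF.mul_left (-Real.Gamma (1 - α))) fun k => ?_)
  · refine ⟨hint, ?_⟩
    have hGq : Real.Gamma (2 - α) = (1 - α) * Real.Gamma (1 - α) := by
      rw [← Real.Gamma_add_one hq.ne']; ring_nf
    have hGp := Real.Gamma_pos_of_pos hq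
    simp only [Finset.range_one, Finset.sum_singleton, Nat.cast_zero, mul_zero, zero_add,
      pow_zero, Real.Gamma_one, Real.rpow_zero, hGq] at hval
    rw [sub_eq_iff_eq_add.1 hval]
    field_simp
    ring
  · have h1 := hG k
    have h2 := hG (k + 1)
    have h3 := hp k
    have hexp : t ^ (1 - α) * t ^ (α * ((k + 1 : ℕ) : ℝ)) = t * t ^ (α * (k : ℝ)) := by
      rw [← Real.rpow_add ht, ← Real.rpow_one_add' ht.le (by positivity)]
      congr 1
      push_cast
      ring
    rw [hexp, show α * ((k + 1 : ℕ) : ℝ) + (2 - α) = α * k + 2 by push_cast; ring, hGadd]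
    field_simp
    ring

/-- The monotone density theorem for a power-law primitive. -/
theorem tendsto_rpow_mul_of_antitoneOn {f : ℝ → ℝ} {ρ C : ℝ} (hf : AntitoneOn f (Ici 0))
    (hcont : Continuous f)
    (hF : Tendsto (fun t => t ^ (-ρ) * ∫ s in (0 : ℝ)..t, f s) atTop (𝓝 C)) :
    Tendsto (fun t => t ^ (1 - ρ) * f t) atTop (𝓝 (C * ρ)) := by
  set W : ℝ → ℝ := fun t => t ^ (-ρ) * ∫ s in (0 : ℝ)..t, f s with hW
  have hslope : Tendsto (fun l : ℝ => C * ((l ^ ρ - 1) / (l - 1))) (𝓝[≠] 1) (𝓝 (C * ρ)) := by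
    have h := (Real.hasDerivAt_rpow_const (x := 1) (p := ρ) (Or.inl one_ne_zero))
    rw [hasDerivAt_iff_tendsto_slope, Real.one_rpow, mul_one] at h
    refine (h.congr fun l => ?_).const_mul C
    rw [slope_def_field, Real.one_rpow]
  have hlim : ∀ l : ℝ, 0 < l → Tendsto (fun t => (l ^ ρ * W (l * t) - W t) / (l - 1)) atTop
      (𝓝 (C * ((l ^ ρ - 1) / (l - 1)))) := fun l hl => by
    have h1 := hF.comp (tendsto_id.const_mul_atTop hl)
    have h2 := ((h1.const_mul (l ^ ρ)).sub hF).div_const (l - 1)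
    rw [show C * ((l ^ ρ - 1) / (l - 1)) = (l ^ ρ * C - C) / (l - 1) by ring]
    exact h2
  have hkey : ∀ l t : ℝ, 0 < l → 0 < t →
      l ^ ρ * W (l * t) - W t ≤ (l - 1) * (t ^ (1 - ρ) * f t) := fun l t hl ht => by
    have hlt : 0 < l * t := mul_pos hl ht
    have hint : ∀ a b, IntervalIntegrable f volume a b := fun a b => hcont.intervalIntegrable a b
    have hdiff : (∫ s in (0 : ℝ)..(l * t), f s) - ∫ s in (0 : ℝ)..t, f s = ∫ s in t..(l * t), f s :=
      intervalIntegral.integral_interval_sub_left (hint _ _) (hint _ _)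
    have hle : ∫ s in t..(l * t), f s ≤ (l - 1) * t * f t := by
      rcases le_total t (l * t) with h | h
      · calc ∫ s in t..(l * t), f s ≤ ∫ s in t..(l * t), f t :=
              intervalIntegral.integral_mono_on h (hint _ _) intervalIntegrable_const
                fun s hs => hf ht.le (ht.le.trans hs.1) hs.1
          _ = (l - 1) * t * f t := by
              rw [intervalIntegral.integral_const, smul_eq_mul]; ring
      · have : ∫ s in (l * t)..t, f t ≤ ∫ s in (l * t)..t, f s :=
          intervalIntegral.integral_mono_on h intervalIntegrable_const (hint _ _)
            fun s hs => hf (hlt.le.trans hs.1) ht.le hs.2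
        rw [intervalIntegral.integral_const, smul_eq_mul] at this
        rw [intervalIntegral.integral_symm]
        linarith
    have hWl : l ^ ρ * W (l * t) = t ^ (-ρ) * ∫ s in (0 : ℝ)..(l * t), f s := by
      simp only [hW]
      rw [Real.mul_rpow hl.le ht.le, ← mul_assoc, ← mul_assoc, ← Real.rpow_add hl,
        add_neg_cancel, Real.rpow_zero, one_mul]
    rw [hWl, hW, ← mul_sub, hdiff, show (1 : ℝ) - ρ = -ρ + 1 by ring, Real.rpow_add_one ht.ne']
    have := mul_le_mul_of_nonneg_left hle (Real.rpow_nonneg ht.le (-ρ))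
    linarith
  rw [tendsto_order]
  constructor
  · intro a ha
    obtain ⟨l, hla, hl⟩ := (((hslope.mono_left (nhdsGT_le_nhdsNE (1 : ℝ))
      ).eventually_const_lt ha).and (self_mem_nhdsWithin (s := Ioi (1 : ℝ)))).exists
    have hl1 : 1 < l := hl
    filter_upwards [(hlim l (zero_lt_one.trans hl1)).eventually_const_lt hla,
      eventually_gt_atTop 0] with t ht ht0
    refine ht.trans_le ?_
    rw [div_le_iff₀ (sub_pos.2 hl1), mul_comm _ (l - 1)]
    exact hkey l t (zero_lt_one.trans hl1) ht0
  · intro a ha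
    obtain ⟨l, ⟨hla, hl⟩, hl0⟩ := ((((hslope.mono_left
      (nhdsLT_le_nhdsNE (1 : ℝ))).eventually_lt_const ha).and
      (self_mem_nhdsWithin (s := Iio (1 : ℝ)))).and
      (mem_nhdsWithin_of_mem_nhds (Ioi_mem_nhds (zero_lt_one (α := ℝ))))).exists
    have hl1 : l < 1 := hl
    have hl0' : 0 < l := hl0
    filter_upwards [(hlim l hl0').eventually_lt_const hla, eventually_gt_atTop 0] with t ht ht0
    refine lt_of_le_of_lt ?_ ht
    rw [le_div_iff_of_neg (sub_neg.2 hl1), mul_comm _ (l - 1)]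
    exact hkey l t hl0' ht0

theorem tendsto_rpow_mul_fractionalRelaxation {α : ℝ} (hα0 : 0 < α) (hα1 : α < 1) :
    Tendsto (fun t => t ^ α * fractionalRelaxation α t) atTop
      (𝓝 (1 / Real.Gamma (1 - α))) := by
  set f := fractionalRelaxation α with hf
  have hq : 0 < 1 - α := by linarith
  have hG := Real.Gamma_pos_of_pos hq
  have hcont : Continuous f := continuous_fractionalRelaxation hα0
  have hanti : AntitoneOn f (Ici 0) := antitoneOn_fractionalRelaxation hα0 hα1
  have hnn : ∀ t, 0 ≤ t → 0 ≤ f t := fun t ht => fractionalRelaxation_nonneg hα0 hα1 ht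
  set C : ℝ := 1 / (Real.Gamma (1 - α) * (1 - α)) with hC
  have hCpos : 0 < C := by positivity
  set P : ℝ → ℝ := fun t => ∫ s in (0 : ℝ)..t, f s * (t - s) ^ (-α) with hP
  have hPnn : ∀ t, 0 ≤ t → 0 ≤ P t := fun t ht =>
    intervalIntegral.integral_nonneg ht fun s hs =>
      mul_nonneg (hnn s hs.1) (Real.rpow_nonneg (sub_nonneg.2 hs.2) _)
  have hFeq : ∀ t, 0 < t → ∫ s in (0 : ℝ)..t, f s =
      C * t ^ (1 - α) - P t / Real.Gamma (1 - α) := fun t ht => by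
    have h := (fractionalRelaxation_integral_eq hα0 hα1 ht).2
    rw [← hf] at h
    have h' : ∫ s in (0 : ℝ)..t, f s =
        (t ^ (1 - α) / (1 - α) - P t) / Real.Gamma (1 - α) := by
      rw [eq_div_iff hG.ne', ← h]
      ring
    rw [h', hC]
    field_simp
  have hbound : ∀ t, 0 < t → f t ≤ C * t ^ (-α) := fun t ht => by
    have h1 : ∫ s in (0 : ℝ)..t, f t ≤ ∫ s in (0 : ℝ)..t, f s :=
      intervalIntegral.integral_mono_on ht.le intervalIntegrable_const
        (hcont.intervalIntegrable _ _) fun s hs => hanti hs.1 ht.le hs.2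
    rw [intervalIntegral.integral_const, smul_eq_mul, sub_zero, hFeq t ht,
      show 1 - α = -α + 1 by ring, Real.rpow_add_one ht.ne'] at h1
    have h2 : 0 ≤ P t / Real.Gamma (-α + 1) := by
      rw [show -α + 1 = 1 - α by ring]
      exact div_nonneg (hPnn t ht.le) hG.le
    refine le_of_mul_le_mul_left (a := t) ?_ ht
    linarith
  set B : ℝ := Real.Gamma (1 - α) * Real.Gamma (1 - α) / Real.Gamma (1 - α + (1 - α))
  have hPle : ∀ t, 0 < t → P t ≤ C * (t ^ (1 - α + (1 - α) - 1) * B) := fun t ht => by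
    obtain ⟨hi, he⟩ := integral_rpow_mul_sub_rpow hq hq ht
    rw [← he, ← intervalIntegral.integral_const_mul]
    refine intervalIntegral.integral_mono_on_of_le_Ioo ht.le
      (fractionalRelaxation_integral_eq hα0 hα1 ht).1 (hi.const_mul C) fun s hs => ?_
    rw [show 1 - α - 1 = -α by ring, ← mul_assoc]
    exact mul_le_mul_of_nonneg_right (hbound s hs.1) (Real.rpow_nonneg (sub_nonneg.2 hs.2.le) _)
  have hPlim : Tendsto (fun t => t ^ (-(1 - α)) * P t) atTop (𝓝 0) := by
    have hz : Tendsto (fun t : ℝ => C * B * t ^ (-α)) atTop (𝓝 0) := by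
      simpa using (tendsto_rpow_neg_atTop hα0).const_mul (C * B)
    refine tendsto_of_tendsto_of_tendsto_of_le_of_le' tendsto_const_nhds hz ?_ ?_
    · filter_upwards [eventually_gt_atTop 0] with t ht
      exact mul_nonneg (Real.rpow_nonneg ht.le _) (hPnn t ht.le)
    · filter_upwards [eventually_gt_atTop 0] with t ht
      have h1 := mul_le_mul_of_nonneg_left (hPle t ht) (Real.rpow_nonneg ht.le (-(1 - α)))
      have h2 : t ^ (-(1 - α)) * t ^ (1 - α + (1 - α) - 1) = t ^ (-α) := by
        rw [← Real.rpow_add ht]; ring_nf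
      calc _ ≤ _ := h1
        _ = C * B * (t ^ (-(1 - α)) * t ^ (1 - α + (1 - α) - 1)) := by ring
        _ = _ := by rw [h2]
  have hFlim : Tendsto (fun t => t ^ (-(1 - α)) * ∫ s in (0 : ℝ)..t, f s) atTop (𝓝 C) := by
    have h := (hPlim.div_const (Real.Gamma (1 - α))).const_sub C
    rw [zero_div, sub_zero] at h
    refine h.congr' ?_
    filter_upwards [eventually_gt_atTop 0] with t ht
    have h1 : t ^ (-(1 - α)) * t ^ (1 - α) = 1 := by
      rw [← Real.rpow_add ht, neg_add_cancel, Real.rpow_zero]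
    rw [hFeq t ht]
    linear_combination -C * h1
  have h := tendsto_rpow_mul_of_antitoneOn hanti hcont hFlim
  rw [sub_sub_cancel] at h
  convert h using 2
  rw [hC]
  field_simp

theorem tendsto_fractionalRelaxation_add_div {α c : ℝ} (hα0 : 0 < α) (hα1 : α < 1) :
    Tendsto (fun t => fractionalRelaxation α (t + c) / fractionalRelaxation α t) atTop (𝓝 1) := by
  have h := tendsto_rpow_mul_fractionalRelaxation hα0 hα1
  have hG : (1 / Real.Gamma (1 - α)) ≠ 0 :=
    one_div_ne_zero (Real.Gamma_pos_of_pos (by linarith)).ne'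
  have hshift := h.comp (tendsto_atTop_add_const_right atTop c tendsto_id)
  have hq : Tendsto (fun t : ℝ => ((t + c) / t) ^ (-α)) atTop (𝓝 1) := by
    have h1 : Tendsto (fun t : ℝ => (t + c) / t) atTop (𝓝 1) := by
      have h2 := (tendsto_const_nhds (x := c)).div_atTop (tendsto_id (α := ℝ) (x := atTop))
      have h3 := h2.const_add 1
      rw [add_zero] at h3
      refine h3.congr' ?_
      filter_upwards [eventually_gt_atTop 0] with t ht
      simp only [id]
      field_simp
    simpa using h1.rpow_const (p := -α) (Or.inl one_ne_zero)
  have hmul := (hshift.div h hG).mul hq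
  rw [div_self hG, one_mul] at hmul
  refine hmul.congr' ?_
  filter_upwards [eventually_gt_atTop 0, eventually_gt_atTop (-c)] with t ht htc
  have htc' : 0 < t + c := by linarith
  have h1 : 0 < t ^ α := by positivity
  have h2 : 0 < (t + c) ^ α := by positivity
  simp only [Function.comp, id, Pi.div_apply]
  rw [Real.div_rpow htc'.le ht.le, Real.rpow_neg htc'.le, Real.rpow_neg ht.le]
  field_simp

/-- Let `α ∈ (0,1)`, `τ₀ > 0`, `c > 0`. Then
`E_α(-((t+c)/τ₀)^α) / E_α(-(t/τ₀)^α) → 1` as `t → +∞`. Consequently, with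
`σ_R(t) = k₀ E_α(-((t+c)/τ₀)^α)` and `σ_F(t) = σ₀ E_α(-(t/τ₀)^α)` where
`k₀ > σ₀ > 0`, the ratio `σ_R(t)/σ_F(t)` tends to `k₀/σ₀` as `t → +∞`. -/
theorem RET_fractional_ratio_limit (α τ₀ c : ℝ) (hα : α ∈ Set.Ioo (0 : ℝ) 1)
    (hτ : 0 < τ₀) (hc : 0 < c) :
    Filter.Tendsto
      (fun t : ℝ => mittagLeffler α 1 (-(((t + c) / τ₀) ^ α)) /
        mittagLeffler α 1 (-((t / τ₀) ^ α)))
      Filter.atTop (nhds 1) ∧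
    ∀ k₀ σ₀ : ℝ, 0 < σ₀ → σ₀ < k₀ →
      Filter.Tendsto
        (fun t : ℝ => (k₀ * mittagLeffler α 1 (-(((t + c) / τ₀) ^ α))) /
          (σ₀ * mittagLeffler α 1 (-((t / τ₀) ^ α))))
        Filter.atTop (nhds (k₀ / σ₀)) := by
  have hmain : Tendsto
      (fun t : ℝ => mittagLeffler α 1 (-(((t + c) / τ₀) ^ α)) /
        mittagLeffler α 1 (-((t / τ₀) ^ α))) atTop (𝓝 1) := by
    have h := (tendsto_fractionalRelaxation_add_div (c := c / τ₀) hα.1 hα.2).comp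
      (tendsto_id.atTop_div_const hτ)
    refine h.congr fun t => ?_
    simp only [Function.comp, id, fractionalRelaxation, add_div]
  refine ⟨hmain, fun k₀ σ₀ _ _ => ?_⟩
  have h := hmain.const_mul (k₀ / σ₀)
  rw [mul_one] at h
  exact h.congr fun t => by rw [mul_div_mul_comm]
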